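/- arXiv:1509.04119 — 2 statements merged into one kernel-verified Lean document; each statement's English description precedes it below -/
import Mathlib

section
/- Define, for real parameters Γ, ρ, β and real l ≥ 1, the exponent function E(Γ, ρ, β, l) = Γ(ρ + β(1−ρ)) − (1/l)·log(1 + Γ(1 + (l−1)ρ)) − (β − 1/l)·log(1 + Γ(1−ρ)). Then for all Γ ≥ 0, l ≥ 1 and 1/l ≤ β ≤ 1, the function ρ ↦ E(Γ, ρ, β, l) is nondecreasing on [0, 1]. -/
/-- The false-alarm error exponent per sensor of the local correlation strategy for the
equicorrelated process (equation (17) of the paper): `Γ` is the effective SNR, `ρ` the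
correlation coefficient, `β` the bandwidth fraction and `l` the cluster size. -/
noncomputable def lcsExponent (Γ ρ β l : ℝ) : ℝ :=
  Γ * (ρ + β * (1 - ρ)) - (1 / l) * Real.log (1 + Γ * (1 + (l - 1) * ρ))
    - (β - 1 / l) * Real.log (1 + Γ * (1 - ρ))

theorem Real.log_le_log_add_sub_div {x y : ℝ} (hx : 0 < x) (hy : 0 < y) :
    Real.log y ≤ Real.log x + (y - x) / x := by
  have h := Real.log_le_sub_one_of_pos (div_pos hy hx)
  rw [Real.log_div hy.ne' hx.ne'] at h
  rw [sub_div, div_self hx.ne']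
  linarith

/-- **Monotonicity of the LCS error exponent in the correlation `ρ`:**
for all `Γ ≥ 0`, `l ≥ 1` and `1/l ≤ β ≤ 1`, `ρ ↦ E(Γ, ρ, β, l)` is nondecreasing
on `[0, 1]` (so `P_fa,LCS` decreases monotonically with `ρ`). -/
theorem lcsExponent_monotoneOn_rho (Γ β l : ℝ)
    (hΓ : 0 ≤ Γ) (hl : 1 ≤ l) (hβl : 1 / l ≤ β) (hβ1 : β ≤ 1) :
    MonotoneOn (fun ρ => lcsExponent Γ ρ β l) (Set.Icc (0 : ℝ) 1) := by
  rintro a ⟨ha0, ha1⟩ b ⟨hb0, hb1⟩ hab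
  simp only [lcsExponent]
  have hl0 : 0 < l := by linarith
  have hk0 : 0 ≤ 1 / l := by positivity
  have hk1 : 1 / l * (l - 1) = 1 - 1 / l := by field_simp
  have hA (x : ℝ) (hx : 0 ≤ x) : 1 ≤ 1 + Γ * (1 + (l - 1) * x) := by
    have := mul_nonneg (sub_nonneg.2 hl) hx
    have : 0 ≤ Γ * (1 + (l - 1) * x) := by positivity
    linarith
  have hB (x : ℝ) (hx : x ≤ 1) : 1 ≤ 1 + Γ * (1 - x) := by
    have := mul_nonneg hΓ (sub_nonneg.2 hx)
    linarith
  have hAB : 1 + Γ * (1 - a) ≤ 1 + Γ * (1 + (l - 1) * a) := by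
    have : 0 ≤ Γ * (l * a) := by positivity
    linarith
  have h1 := mul_le_mul_of_nonneg_left (Real.log_le_log_add_sub_div
    (zero_lt_one.trans_le (hA a ha0)) (zero_lt_one.trans_le (hA b hb0))) hk0
  have h2 := mul_le_mul_of_nonneg_left (Real.log_le_log_add_sub_div
    (zero_lt_one.trans_le (hB a ha1)) (zero_lt_one.trans_le (hB b hb1))) (sub_nonneg.2 hβl)
  have hBi : (1 + Γ * (1 - a))⁻¹ ≤ 1 := inv_le_one_of_one_le₀ (hB a ha1)
  have hABi : (1 + Γ * (1 + (l - 1) * a))⁻¹ ≤ (1 + Γ * (1 - a))⁻¹ :=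
    inv_anti₀ (zero_lt_one.trans_le (hB a ha1)) hAB
  rw [div_eq_mul_inv (_ - _)] at h1 h2
  generalize (1 + Γ * (1 - a))⁻¹ = v at *
  generalize (1 + Γ * (1 + (l - 1) * a))⁻¹ = u at *
  have slope_nonneg : 0 ≤ Γ * (b - a) * ((1 - β) * (1 - v) + (1 - 1 / l) * (v - u)) := by
    have := sub_nonneg.2 hab
    have := sub_nonneg.2 hβ1
    have := sub_nonneg.2 (hβl.trans hβ1)
    have := sub_nonneg.2 hBi
    have := sub_nonneg.2 hABi
    positivity
  linear_combination h1 + h2 + slope_nonneg + Γ * (b - a) * u * hk1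
end

section
/- Define, for real parameters Γ, ρ, β and real l ≥ 1, the exponent function E(Γ, ρ, β, l) = Γ(ρ + β(1−ρ)) − (1/l)·log(1 + Γ(1 + (l−1)ρ)) − (β − 1/l)·log(1 + Γ(1−ρ)). Then for all fixed Γ ≥ 0, ρ ∈ [0,1] and β ∈ ℝ, the function l ↦ E(Γ, ρ, β, l) is nondecreasing on the real interval [1, ∞). -/
/-- The secant slope from `0` of `t ↦ log (a + t * b)` is antitone, by concavity of `log`. -/
theorem log_secant_slope_antitone {a b x y : ℝ} (ha : 0 < a) (hb : 0 ≤ b)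
    (hx : 0 < x) (hxy : x ≤ y) :
    (1 / y) * (Real.log (a + y * b) - Real.log a) ≤
      (1 / x) * (Real.log (a + x * b) - Real.log a) := by
  have hy : 0 < y := hx.trans_le hxy
  have hconc := strictConcaveOn_log_Ioi.concaveOn.2
    (Set.mem_Ioi.2 ha) (Set.mem_Ioi.2 (by positivity : 0 < a + y * b))
    (sub_nonneg.2 ((div_le_one hy).2 hxy)) (by positivity : 0 ≤ x / y) (by ring)
  simp only [smul_eq_mul] at hconc
  have hpoint : (1 - x / y) * a + x / y * (a + y * b) = a + x * b := by
    field_simp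
    ring
  rw [hpoint] at hconc
  have hscale : (1 / y) * (Real.log (a + y * b) - Real.log a) =
      (1 / x) * (x / y * (Real.log (a + y * b) - Real.log a)) := by
    field_simp
  rw [hscale]
  exact mul_le_mul_of_nonneg_left (by linarith) (by positivity)

/-- **Monotonicity of the LCS error exponent in the cluster size `l`:**
for fixed `Γ ≥ 0`, `ρ ∈ [0,1]` and `β ∈ ℝ`, `l ↦ E(Γ, ρ, β, l)` is nondecreasing on
the real interval `[1, ∞)`. -/
theorem lcsExponent_monotoneOn_l (Γ ρ β : ℝ)
    (hΓ : 0 ≤ Γ) (hρ : ρ ∈ Set.Icc (0 : ℝ) 1) :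
    MonotoneOn (fun l => lcsExponent Γ ρ β l) (Set.Ici (1 : ℝ)) := by
  intro x hx y _ hxy
  have ha : 0 < 1 + Γ * (1 - ρ) := by
    have := mul_nonneg hΓ (sub_nonneg.2 hρ.2)
    linarith
  have hslope := log_secant_slope_antitone ha (mul_nonneg hΓ hρ.1)
    (zero_lt_one.trans_le hx) hxy
  have harg (l : ℝ) : 1 + Γ * (1 + (l - 1) * ρ) = 1 + Γ * (1 - ρ) + l * (Γ * ρ) := by ring
  simp only [lcsExponent, harg]
  linarith
end
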